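/- Let T > 0, α₁ > 1/2, and α₂ > 1 − α₁, and fix β ∈ (1−α₁, min(1/2, α₂)). Let (V_t)_{t∈[0,T]} be a jointly measurable real-valued stochastic process whose sample paths are almost surely H-Hölder continuous for every H < 1/2 and which satisfies the bounded-density assumption with some nonnegative g ∈ L¹([0,T]) (for instance V = X + M with X almost surely α₁-Hölder and M a continuous martingale with absolutely continuous quadratic variation). Let (J_t)_{t∈[0,T]} be a jointly measurable process, independent of V, with almost surely bounded sample paths and satisfying P(J_s ≠ J_t) ≤ C|t−s|^{α₂} for all s,t ∈ [0,T] and some constant C. Let f : ℝ → ℝ be of locally bounded variation and set Y_t := V_t + J_t. Then almost surely ∫₀^T |f(Y_s)| s^{−β} ds < ∞ and ∫₀^T ∫₀^t |f(Y_t) − f(Y_s)| (t−s)^{−1−β} ds dt < ∞, i.e., ‖f(Y_·)‖_{2,β} < ∞ almost surely; consequently, for any process X with almost surely α₁-Hölder sample paths the generalized Lebesgue–Stieltjes integral ∫₀^T f(Y_s) dX_s exists almost surely. -/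

import Mathlib

open MeasureTheory ProbabilityTheory Set
open scoped ENNReal

noncomputable section

/-- `x` is `α`-Hölder continuous on `[0,T]`. -/
def HolderOnIcc (α T : ℝ) (x : ℝ → ℝ) : Prop :=
  ∃ C : ℝ, ∀ s ∈ Set.Icc (0:ℝ) T, ∀ t ∈ Set.Icc (0:ℝ) T, |x t - x s| ≤ C * |t - s| ^ α

/-- The bounded-density assumption: for a.e. `t ∈ [0,T]`, the law of `V_t` is bounded above by
`g t` times Lebesgue measure. -/
def BoundedDensityAssumption {Ω : Type*} [MeasurableSpace Ω] (P : Measure Ω)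
    (T : ℝ) (V : ℝ → Ω → ℝ) (g : ℝ → ℝ) : Prop :=
  ∀ᵐ t ∂(volume.restrict (Set.Icc (0:ℝ) T)),
    ∀ A : Set ℝ, MeasurableSet A → P {ω | V t ω ∈ A} ≤ ENNReal.ofReal (g t) * volume A
open Filter Topology

lemma aux_shift (w : ℝ → ℝ) (hw : Monotone w) (K : ℝ) (hK : ∀ x y, w x - w y ≤ K)
    (δ : ℝ) (hδ : 0 ≤ δ) :
    ∫⁻ x, ENNReal.ofReal (w (x + δ) - w (x - δ)) ≤ ENNReal.ofReal (2 * δ * K) := by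
  have hwm : Measurable w := hw.measurable
  have hm : Measurable (fun x => ENNReal.ofReal (w (x + δ) - w (x - δ))) := by fun_prop
  have hii : ∀ a b : ℝ, IntervalIntegrable w volume a b := fun a b => hw.intervalIntegrable
  have hs1 : ∀ c a b : ℝ, IntervalIntegrable (fun x => w (x + c)) volume a b := fun c a b =>
    Monotone.intervalIntegrable (fun x y h => hw (by linarith))
  have hs2 : ∀ c a b : ℝ, IntervalIntegrable (fun x => w (x - c)) volume a b := fun c a b =>
    Monotone.intervalIntegrable (fun x y h => hw (by linarith))
  have hcov : AECover (volume : Measure ℝ) atTop (fun n : ℕ => Ioc (-(n:ℝ)) n) :=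
    aecover_Ioc (tendsto_neg_atTop_atBot.comp tendsto_natCast_atTop_atTop)
      tendsto_natCast_atTop_atTop
  refine le_of_tendsto' (hcov.lintegral_tendsto_of_nat hm.aemeasurable) (fun n => ?_)
  have hR0 : (0:ℝ) ≤ n := by positivity
  generalize (n:ℝ) = R at hR0 ⊢
  have hint : IntegrableOn (fun x => w (x + δ) - w (x - δ)) (Ioc (-R) R) := by
    have := (hs1 δ (-R) R).sub (hs2 δ (-R) R)
    rwa [intervalIntegrable_iff_integrableOn_Ioc_of_le (by linarith)] at this
  rw [← ofReal_integral_eq_lintegral_ofReal hint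
    (Eventually.of_forall fun x => sub_nonneg.2 (hw (by linarith)))]
  apply ENNReal.ofReal_le_ofReal
  rw [← intervalIntegral.integral_of_le (by linarith),
    intervalIntegral.integral_sub (hs1 δ _ _) (hs2 δ _ _),
    intervalIntegral.integral_comp_add_right, intervalIntegral.integral_comp_sub_right,
    intervalIntegral.integral_interval_sub_interval_comm' (hii _ _) (hii _ _) (hii _ _)]
  have e1 : ∫ x in (R - δ)..(R + δ), w x = ∫ x in (-δ)..δ, w (x + R) := by
    rw [intervalIntegral.integral_comp_add_right]; congr 1 <;> ring
  have e2 : ∫ x in (-R - δ)..(-R + δ), w x = ∫ x in (-δ)..δ, w (x - R) := by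
    rw [intervalIntegral.integral_comp_sub_right]; congr 1 <;> ring
  rw [e1, e2, ← intervalIntegral.integral_sub (hs1 _ _ _) (hs2 _ _ _)]
  calc _ ≤ ∫ x in (-δ)..δ, K := by
        apply intervalIntegral.integral_mono_on (by linarith)
          ((hs1 _ _ _).sub (hs2 _ _ _)) (by simp)
        intro x _; exact hK _ _
    _ = 2 * δ * K := by rw [intervalIntegral.integral_const, smul_eq_mul]; ring

lemma aux_rpow_fin (T p : ℝ) (hp : -1 < p) :
    ∫⁻ r in Ioo (0:ℝ) T, ENNReal.ofReal (r ^ p) < ⊤ := by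
  rcases le_or_gt T 0 with h | h
  · rw [Ioo_eq_empty (by linarith)]; simp
  have h1 : IntegrableOn (fun r : ℝ => r ^ p) (Ioo 0 T) :=
    (intervalIntegral.integrableOn_Ioo_rpow_iff h).2 hp
  exact (hasFiniteIntegral_iff_ofReal ((ae_restrict_iff' measurableSet_Ioo).2
    (Eventually.of_forall fun r hr => Real.rpow_nonneg hr.1.le p))).1 h1.2

lemma aux_rpow_left (T p t : ℝ) (ht : t ≤ T) :
    ∫⁻ s in Ioo (0:ℝ) t, ENNReal.ofReal ((t - s) ^ p) ≤
      ∫⁻ r in Ioo (0:ℝ) T, ENNReal.ofReal (r ^ p) := by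
  rw [← lintegral_indicator measurableSet_Ioo, ← lintegral_indicator measurableSet_Ioo,
    ← lintegral_sub_left_eq_self _ t]
  apply lintegral_mono
  intro s
  beta_reduce
  by_cases h : t - s ∈ Ioo 0 t
  · rw [indicator_of_mem h, indicator_of_mem (by constructor <;> linarith [h.1, h.2])]
    simp
  · rw [indicator_of_notMem h]; simp

lemma aux_rpow_right (T p s : ℝ) (hs : 0 ≤ s) :
    ∫⁻ u in Ioo s T, ENNReal.ofReal ((u - s) ^ p) ≤
      ∫⁻ r in Ioo (0:ℝ) T, ENNReal.ofReal (r ^ p) := by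
  rw [← lintegral_indicator measurableSet_Ioo, ← lintegral_indicator measurableSet_Ioo,
    ← lintegral_add_right_eq_self _ s]
  apply lintegral_mono
  intro u
  beta_reduce
  by_cases h : u + s ∈ Ioo s T
  · rw [indicator_of_mem h, indicator_of_mem (by constructor <;> linarith [h.1, h.2])]
    simp
  · rw [indicator_of_notMem h]; simp

lemma aux_dens {Ω : Type*} [MeasurableSpace Ω] (P : Measure Ω) [IsProbabilityMeasure P]
    (A B : Ω → ℝ) (hA : Measurable A) (hB : Measurable B) (hAB : IndepFun A B P) (c : ℝ≥0∞)
    (hc : ∀ S : Set ℝ, MeasurableSet S → P {ω | A ω ∈ S} ≤ c * volume S)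
    (φ : ℝ → ℝ≥0∞) (hφ : Measurable φ) :
    ∫⁻ ω, φ (A ω + B ω) ∂P ≤ c * ∫⁻ x, φ x := by
  have hle : P.map A ≤ c • (volume : Measure ℝ) := by
    refine Measure.le_iff.2 fun S hS => ?_
    rw [Measure.map_apply hA hS]; exact hc S hS
  have hpB : IsProbabilityMeasure (P.map B) := Measure.isProbabilityMeasure_map hB.aemeasurable
  have hpA : IsProbabilityMeasure (P.map A) := Measure.isProbabilityMeasure_map hA.aemeasurable
  have h1 : ∫⁻ ω, φ (A ω + B ω) ∂P = ∫⁻ z, φ (z.1 + z.2) ∂((P.map A).prod (P.map B)) := by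
    rw [← (indepFun_iff_map_prod_eq_prod_map_map hA.aemeasurable hB.aemeasurable).1 hAB,
      lintegral_map (by fun_prop) (by fun_prop)]
  rw [h1, lintegral_prod_symm _ (by fun_prop)]
  calc _ ≤ ∫⁻ _, (c * ∫⁻ x, φ x) ∂(P.map B) := by
        apply lintegral_mono
        intro y
        calc ∫⁻ x, φ (x + y) ∂(P.map A) ≤ ∫⁻ x, φ (x + y) ∂(c • (volume : Measure ℝ)) :=
              lintegral_mono' hle le_rfl
          _ = c * ∫⁻ x, φ x := by
              rw [lintegral_smul_measure, lintegral_add_right_eq_self φ y, smul_eq_mul]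
    _ = _ := by simp

lemma aux_bv (f : ℝ → ℝ) (hf : LocallyBoundedVariationOn f Set.univ) :
    Measurable f ∧ ∃ v : ℝ → ℝ, Monotone v ∧ ∀ x y, |f x - f y| ≤ |v x - v y| := by
  constructor
  · obtain ⟨p, q, hp, hq, h⟩ := hf.exists_monotoneOn_sub_monotoneOn
    rw [h]
    exact (monotoneOn_univ.1 hp).measurable.sub (monotoneOn_univ.1 hq).measurable
  · refine ⟨variationOnFromTo f univ 0,
      monotoneOn_univ.1 (variationOnFromTo.monotoneOn hf (mem_univ 0)), fun x y => ?_⟩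
    have key : ∀ x y, x ≤ y → |f x - f y| ≤
        |variationOnFromTo f univ 0 x - variationOnFromTo f univ 0 y| := by
      intro x y hxy
      rw [abs_sub_comm (variationOnFromTo _ _ _ _), variationOnFromTo.sub_right hf (mem_univ _) (mem_univ _) (mem_univ _),
        variationOnFromTo.eq_of_le _ _ hxy, abs_of_nonneg ENNReal.toReal_nonneg, ← Real.dist_eq,
        dist_edist]
      apply ENNReal.toReal_mono (hf x y (mem_univ _) (mem_univ _))
      exact eVariationOn.edist_le _ ⟨mem_univ _, le_rfl, hxy⟩ ⟨mem_univ _, hxy, le_rfl⟩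
    rcases le_total x y with h | h
    · exact key x y h
    · rw [abs_sub_comm, abs_sub_comm (variationOnFromTo _ _ _ x)]; exact key y x h

lemma aux_core
    {Ω : Type*} [MeasurableSpace Ω] (P : Measure Ω) [IsProbabilityMeasure P]
    (T α₂ β C : ℝ) (hC : 0 ≤ C) (hβ : β < α₂)
    (V : ℝ → Ω → ℝ) (hV : Measurable (Function.uncurry V))
    (g : ℝ → ℝ) (hgL1 : IntegrableOn g (Set.Icc 0 T))
    (hdens : BoundedDensityAssumption P T V g)
    (J : ℝ → Ω → ℝ) (hJ : Measurable (Function.uncurry J))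
    (hindep : IndepFun (fun ω => fun t => V t ω) (fun ω => fun t => J t ω) P)
    (hjump : ∀ s ∈ Set.Icc (0:ℝ) T, ∀ t ∈ Set.Icc (0:ℝ) T,
      P {ω | J s ω ≠ J t ω} ≤ ENNReal.ofReal (C * |t - s| ^ α₂))
    (w : ℝ → ℝ) (hw : Monotone w) (K : ℝ) (hK0 : 0 ≤ K) (hK : ∀ x y, w x - w y ≤ K)
    (H L : ℝ) (hL : 0 ≤ L) (hH : β < H) :
    ∀ᵐ ω ∂P, ∫⁻ t in Ioo (0:ℝ) T, ∫⁻ s in Ioo (0:ℝ) t,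
      ENNReal.ofReal ((if |V t ω - V s ω| ≤ L * |t - s| ^ H then
        |w (V t ω + J t ω) - w (V s ω + J s ω)| else 0) * (t - s) ^ (-(1 + β))) < ⊤ := by
  have hwm : Measurable w := hw.measurable
  let F : Ω → ℝ → ℝ → ℝ≥0∞ := fun ω t s =>
    ENNReal.ofReal ((if |V t ω - V s ω| ≤ L * |t - s| ^ H then
        |w (V t ω + J t ω) - w (V s ω + J s ω)| else 0) * (t - s) ^ (-(1 + β)))
  let G : Ω → ℝ → ℝ → ℝ≥0∞ := fun ω t s => (Ioo (0:ℝ) t).indicator (F ω t) s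
  have hGm : Measurable (fun p : (Ω × ℝ) × ℝ => G p.1.1 p.1.2 p.2) := by
    have h1 : Measurable (fun p : (Ω × ℝ) × ℝ => V p.1.2 p.1.1) :=
      hV.comp (by fun_prop : Measurable (fun p : (Ω × ℝ) × ℝ => (p.1.2, p.1.1)))
    have h2 : Measurable (fun p : (Ω × ℝ) × ℝ => V p.2 p.1.1) :=
      hV.comp (by fun_prop : Measurable (fun p : (Ω × ℝ) × ℝ => (p.2, p.1.1)))
    have h3 : Measurable (fun p : (Ω × ℝ) × ℝ => J p.1.2 p.1.1) :=
      hJ.comp (by fun_prop : Measurable (fun p : (Ω × ℝ) × ℝ => (p.1.2, p.1.1)))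
    have h4 : Measurable (fun p : (Ω × ℝ) × ℝ => J p.2 p.1.1) :=
      hJ.comp (by fun_prop : Measurable (fun p : (Ω × ℝ) × ℝ => (p.2, p.1.1)))
    have hF : Measurable (fun p : (Ω × ℝ) × ℝ => F p.1.1 p.1.2 p.2) := by
      apply Measurable.ennreal_ofReal
      apply Measurable.mul
      · apply Measurable.ite
        · apply measurableSet_le
          · exact (h1.sub h2).abs
          · have : Measurable (fun p : (Ω × ℝ) × ℝ => |p.1.2 - p.2|) :=
              (by fun_prop : Measurable (fun p : (Ω × ℝ) × ℝ => p.1.2 - p.2)).abs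
            exact (this.pow_const H).const_mul L
        · exact ((hwm.comp (h1.add h3)).sub (hwm.comp (h2.add h4))).abs
        · exact measurable_const
      · fun_prop
    have hS : MeasurableSet {p : (Ω × ℝ) × ℝ | 0 < p.2 ∧ p.2 < p.1.2} :=
      (measurableSet_lt (f := fun _ : (Ω × ℝ) × ℝ => (0:ℝ)) (g := fun p => p.2)
        (by fun_prop) (by fun_prop)).inter
        (measurableSet_lt (f := fun p : (Ω × ℝ) × ℝ => p.2) (g := fun p => p.1.2)
          (by fun_prop) (by fun_prop))
    exact hF.indicator hS
  have hGm2 : Measurable (fun p : Ω × ℝ => ∫⁻ s, G p.1 p.2 s) := hGm.lintegral_prod_right'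
  have hΦ : Measurable (fun ω => ∫⁻ t in Ioo (0:ℝ) T, ∫⁻ s, G ω t s) :=
    hGm2.lintegral_prod_right'
  have hGF : ∀ ω t, ∫⁻ s, G ω t s = ∫⁻ s in Ioo (0:ℝ) t, F ω t s := fun ω t =>
    lintegral_indicator measurableSet_Ioo _
  suffices hfin : ∫⁻ ω, (∫⁻ t in Ioo (0:ℝ) T, (∫⁻ s, G ω t s)) ∂P < ⊤ by
    filter_upwards [ae_lt_top hΦ hfin.ne] with ω hω
    simpa only [hGF] using hω
  rw [lintegral_lintegral_swap hGm2.aemeasurable]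
  set c1 := ∫⁻ r in Ioo (0:ℝ) T, ENNReal.ofReal (r ^ (H - (1 + β))) with hc1
  set c2 := ∫⁻ r in Ioo (0:ℝ) T, ENNReal.ofReal (r ^ (α₂ - (1 + β))) with hc2
  have hc1t : c1 < ⊤ := aux_rpow_fin T _ (by linarith)
  have hc2t : c2 < ⊤ := aux_rpow_fin T _ (by linarith)
  have hpt : ∀ᵐ t ∂(volume.restrict (Ioo (0:ℝ) T)), ∫⁻ ω, (∫⁻ s, G ω t s) ∂P ≤
      ENNReal.ofReal (g t) * (ENNReal.ofReal (2 * L * K) * c1) + ENNReal.ofReal (K * C) * c2 := by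
    have hd := ae_restrict_of_ae_restrict_of_subset (Ioo_subset_Icc_self) hdens
    filter_upwards [hd, ae_restrict_mem measurableSet_Ioo] with t ht htT
    have hVt : Measurable (V t) := hV.comp measurable_prodMk_left
    have hJt : Measurable (J t) := hJ.comp measurable_prodMk_left
    have hi : IndepFun (V t) (J t) P :=
      hindep.comp (measurable_pi_apply t) (measurable_pi_apply t)
    rw [lintegral_lintegral_swap]
    swap
    · exact (hGm.comp (by fun_prop : Measurable fun p : Ω × ℝ => ((p.1, t), p.2))).aemeasurable
    have hs : ∀ s, ∫⁻ ω, G ω t s ∂P ≤ (Ioo (0:ℝ) t).indicator (fun s =>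
        ENNReal.ofReal (g t) * ENNReal.ofReal (2 * L * K) *
          ENNReal.ofReal ((t - s) ^ (H - (1 + β))) +
        ENNReal.ofReal (K * C) * ENNReal.ofReal ((t - s) ^ (α₂ - (1 + β)))) s := by
      intro s
      by_cases hst : s ∈ Ioo 0 t
      swap
      · simp [G, indicator_of_notMem hst]
      simp only [G, indicator_of_mem hst]
      have hh : 0 < t - s := by linarith [hst.2]
      have habs : |t - s| = t - s := abs_of_pos hh
      have hJs : Measurable (J s) := hJ.comp measurable_prodMk_left
      set δ := L * (t - s) ^ H with hδ
      have hδ0 : 0 ≤ δ := mul_nonneg hL (Real.rpow_nonneg hh.le _)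
      set k := (t - s) ^ (-(1 + β)) with hk
      have hk0 : 0 ≤ k := Real.rpow_nonneg hh.le _
      have hbm : MeasurableSet {ω | J s ω ≠ J t ω} := (measurableSet_eq_fun hJs hJt).compl
      have hpw : ∀ ω, F ω t s ≤ (ENNReal.ofReal (w (V t ω + J t ω + δ) - w (V t ω + J t ω - δ)) +
          {ω | J s ω ≠ J t ω}.indicator (fun _ => ENNReal.ofReal K) ω) * ENNReal.ofReal k := by
        intro ω
        simp only [F]
        rw [habs, ← hδ, ← hk, ENNReal.ofReal_mul' hk0]
        gcongr
        split_ifs with hd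
        swap
        · simp
        by_cases hj : J s ω = J t ω
        · refine le_trans ?_ le_self_add
          apply ENNReal.ofReal_le_ofReal
          rw [hj]
          obtain ⟨ha, hb⟩ := abs_le.1 hd
          have m1 : w (V s ω + J t ω) ≤ w (V t ω + J t ω + δ) := hw (by linarith)
          have m2 : w (V t ω + J t ω - δ) ≤ w (V s ω + J t ω) := hw (by linarith)
          have m3 : w (V t ω + J t ω) ≤ w (V t ω + J t ω + δ) := hw (by linarith)
          have m4 : w (V t ω + J t ω - δ) ≤ w (V t ω + J t ω) := hw (by linarith)
          rw [abs_le]; constructor <;> linarith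
        · refine le_trans ?_ le_add_self
          rw [indicator_of_mem (by exact hj)]
          apply ENNReal.ofReal_le_ofReal
          rw [abs_le]; constructor
          · linarith [hK (V s ω + J s ω) (V t ω + J t ω)]
          · exact hK _ _
      have hφ : Measurable (fun x => ENNReal.ofReal (w (x + δ) - w (x - δ))) := by fun_prop
      calc ∫⁻ ω, F ω t s ∂P ≤ ∫⁻ ω, (ENNReal.ofReal (w (V t ω + J t ω + δ) - w (V t ω + J t ω - δ)) +
          {ω | J s ω ≠ J t ω}.indicator (fun _ => ENNReal.ofReal K) ω) * ENNReal.ofReal k ∂P :=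
            lintegral_mono hpw
        _ = (∫⁻ ω, ENNReal.ofReal (w (V t ω + J t ω + δ) - w (V t ω + J t ω - δ)) ∂P +
            ENNReal.ofReal K * P {ω | J s ω ≠ J t ω}) * ENNReal.ofReal k := by
            rw [lintegral_mul_const' _ _ ENNReal.ofReal_ne_top, lintegral_add_right _
              (measurable_const.indicator hbm), lintegral_indicator_const hbm]
        _ ≤ (ENNReal.ofReal (g t) * ENNReal.ofReal (2 * δ * K) +
            ENNReal.ofReal K * ENNReal.ofReal (C * (t - s) ^ α₂)) * ENNReal.ofReal k := by
            gcongr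
            · refine (aux_dens P (V t) (J t) hVt hJt hi _ ht _ hφ).trans ?_
              gcongr
              exact aux_shift w hw K hK δ hδ0
            · have := hjump s ⟨hst.1.le, by linarith [hst.2, htT.2]⟩ t ⟨htT.1.le, htT.2.le⟩
              rwa [habs] at this
        _ = _ := by
            have hp1 : 0 ≤ (t - s) ^ α₂ := Real.rpow_nonneg hh.le _
            have e1 : (t - s) ^ (H - (1 + β)) = (t - s) ^ H * k := by
              rw [hk, ← Real.rpow_add hh]; ring_nf
            have e2 : (t - s) ^ (α₂ - (1 + β)) = (t - s) ^ α₂ * k := by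
              rw [hk, ← Real.rpow_add hh]; ring_nf
            have q1 : ENNReal.ofReal (2 * δ * K) * ENNReal.ofReal k =
                ENNReal.ofReal (2 * L * K) * ENNReal.ofReal ((t - s) ^ (H - (1 + β))) := by
              rw [← ENNReal.ofReal_mul (mul_nonneg (by linarith) hK0),
                ← ENNReal.ofReal_mul (by positivity), e1]
              simp only [δ]
              congr 1; ring
            have q2 : ENNReal.ofReal K * ENNReal.ofReal (C * (t - s) ^ α₂) * ENNReal.ofReal k =
                ENNReal.ofReal (K * C) * ENNReal.ofReal ((t - s) ^ (α₂ - (1 + β))) := by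
              rw [← ENNReal.ofReal_mul hK0, ← ENNReal.ofReal_mul
                (mul_nonneg hK0 (mul_nonneg hC hp1)), ← ENNReal.ofReal_mul (mul_nonneg hK0 hC), e2]
              congr 1; ring
            rw [add_mul, mul_assoc (ENNReal.ofReal (g t)), q1, q2, mul_assoc (ENNReal.ofReal (g t))]
    calc ∫⁻ s, ∫⁻ ω, G ω t s ∂P ≤ _ := lintegral_mono hs
      _ = ENNReal.ofReal (g t) * ENNReal.ofReal (2 * L * K) *
            (∫⁻ s in Ioo 0 t, ENNReal.ofReal ((t - s) ^ (H - (1 + β)))) +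
          ENNReal.ofReal (K * C) *
            ∫⁻ s in Ioo 0 t, ENNReal.ofReal ((t - s) ^ (α₂ - (1 + β))) := by
          rw [lintegral_indicator measurableSet_Ioo, lintegral_add_left (by fun_prop),
            lintegral_const_mul _ (by fun_prop), lintegral_const_mul _ (by fun_prop)]
      _ ≤ _ := by
          rw [← mul_assoc]
          gcongr
          · exact aux_rpow_left T _ t htT.2.le
          · exact aux_rpow_left T _ t htT.2.le
  refine (lintegral_mono_ae hpt).trans_lt ?_
  have hgi : ∫⁻ t in Ioo (0:ℝ) T, ENNReal.ofReal (g t) < ⊤ :=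
    (lintegral_mono fun t => Real.ofReal_le_enorm _).trans_lt
      (hgL1.mono_set Ioo_subset_Icc_self).2
  rw [lintegral_add_right _ measurable_const, lintegral_mul_const' _ _
    (ENNReal.mul_lt_top ENNReal.ofReal_lt_top hc1t).ne]
  simp only [lintegral_const, Measure.restrict_apply_univ, Real.volume_Ioo]
  exact ENNReal.add_lt_top.2 ⟨ENNReal.mul_lt_top hgi (ENNReal.mul_lt_top ENNReal.ofReal_lt_top hc1t),
    ENNReal.mul_lt_top (ENNReal.mul_lt_top ENNReal.ofReal_lt_top hc2t) ENNReal.ofReal_lt_top⟩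

lemma aux_holder_cont (α T : ℝ) (hα : 0 < α) (x : ℝ → ℝ) (hx : HolderOnIcc α T x) :
    ContinuousOn x (Icc 0 T) := by
  obtain ⟨C, hC⟩ := hx
  intro s hs
  rw [ContinuousWithinAt, tendsto_iff_dist_tendsto_zero]
  have h0 : Tendsto (fun t : ℝ => C * |t - s| ^ α) (𝓝[Icc 0 T] s) (𝓝 0) := by
    have : Continuous (fun t : ℝ => C * |t - s| ^ α) :=
      continuous_const.mul ((by fun_prop : Continuous fun t : ℝ => |t - s|).rpow_const
        (fun _ => Or.inr hα.le))
    have h := this.tendsto s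
    simp only [sub_self, abs_zero, Real.zero_rpow hα.ne', mul_zero] at h
    exact h.mono_left nhdsWithin_le_nhds
  refine squeeze_zero' (Eventually.of_forall fun _ => dist_nonneg) ?_ h0
  filter_upwards [self_mem_nhdsWithin] with t ht
  exact hC s hs t ht

lemma aux_det (T α₁ β : ℝ) (hT : 0 < T) (hα₁ : 0 < α₁) (hβ : 1 - α₁ < β)
    (φ : ℝ → ℝ) (hφ : Measurable φ)
    (hA : (∫⁻ s in Set.Ioo (0:ℝ) T, ENNReal.ofReal (|φ s| * s ^ (-β))) < ⊤)
    (hB : (∫⁻ t in Set.Ioo (0:ℝ) T, ∫⁻ s in Set.Ioo (0:ℝ) t,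
        ENNReal.ofReal (|φ t - φ s| * (t - s) ^ (-(1 + β)))) < ⊤)
    (x : ℝ → ℝ) (hx : HolderOnIcc α₁ T x) :
    (∀ᵐ s ∂(volume.restrict (Set.Ioo (0:ℝ) T)),
          IntegrableOn (fun u => (φ s - φ u) * (s - u) ^ (-(1 + β)))
            (Set.Ioo (0:ℝ) s) ∧
          IntegrableOn (fun u => (x s - x u) * (u - s) ^ (-(2 - β))) (Set.Ioo s T)) ∧
        IntegrableOn (fun s =>
            (φ s * s ^ (-β) +
              β * ∫ u in Set.Ioo (0:ℝ) s, (φ s - φ u) * (s - u) ^ (-(1 + β))) *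
            ((x s - x T) * (T - s) ^ (-(1 - β)) +
              (1 - β) * ∫ u in Set.Ioo s T, (x s - x u) * (u - s) ^ (-(2 - β))))
          (Set.Ioo (0:ℝ) T) := by
  have hxc := aux_holder_cont α₁ T hα₁ x hx
  obtain ⟨C, hC⟩ := hx
  -- enorm of the first kernel
  have en1 : ∀ s, ∫⁻ u in Ioo (0:ℝ) s, ‖(φ s - φ u) * (s - u) ^ (-(1 + β))‖ₑ =
      ∫⁻ u in Ioo (0:ℝ) s, ENNReal.ofReal (|φ s - φ u| * (s - u) ^ (-(1 + β))) := by
    intro s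
    refine setLIntegral_congr_fun measurableSet_Ioo (fun u hu => ?_)
    rw [← ofReal_norm, norm_mul, Real.norm_eq_abs, Real.norm_eq_abs,
      abs_of_nonneg (Real.rpow_nonneg (by linarith [hu.2] : 0 ≤ s - u) _)]
  have hker : Measurable (fun p : ℝ × ℝ => (φ p.1 - φ p.2) * (p.1 - p.2) ^ (-(1 + β))) := by
    fun_prop
  have hS : MeasurableSet {p : ℝ × ℝ | p.2 ∈ Ioo 0 p.1} :=
    (measurableSet_lt (f := fun _ : ℝ × ℝ => (0:ℝ)) (g := fun p => p.2)
        (by fun_prop) (by fun_prop)).inter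
        (measurableSet_lt (f := fun p : ℝ × ℝ => p.2) (g := fun p => p.1)
          (by fun_prop) (by fun_prop))
  have hlm : Measurable (fun s => ∫⁻ u in Ioo (0:ℝ) s,
      ‖(φ s - φ u) * (s - u) ^ (-(1 + β))‖ₑ) := by
    have := ((hker.enorm).indicator hS).lintegral_prod_right' (ν := (volume : Measure ℝ))
    convert this using 2 with s
    rw [← lintegral_indicator measurableSet_Ioo]; rfl
  have hB' : ∫⁻ s in Ioo (0:ℝ) T, ∫⁻ u in Ioo (0:ℝ) s,
      ‖(φ s - φ u) * (s - u) ^ (-(1 + β))‖ₑ < ⊤ := by simpa only [en1] using hB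
  -- second kernel
  set c3 := ∫⁻ r in Ioo (0:ℝ) T, ENNReal.ofReal (r ^ (α₁ - (2 - β))) with hc3
  have hc3t : c3 < ⊤ := aux_rpow_fin T _ (by linarith)
  have hC' : ∀ s ∈ Icc (0:ℝ) T, ∀ t ∈ Icc (0:ℝ) T, s ≤ t → |x s - x t| ≤ |C| * (t - s) ^ α₁ := by
    intro s hs t ht hst
    have := hC s hs t ht
    rw [abs_sub_comm, abs_of_nonneg (sub_nonneg.2 hst)] at this
    refine this.trans (mul_le_mul_of_nonneg_right (le_abs_self C) ?_)
    exact Real.rpow_nonneg (sub_nonneg.2 hst) _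
  have en2 : ∀ s ∈ Ioo (0:ℝ) T, ∫⁻ u in Ioo s T, ‖(x s - x u) * (u - s) ^ (-(2 - β))‖ₑ ≤
      ENNReal.ofReal |C| * c3 := by
    intro s hs
    calc _ ≤ ∫⁻ u in Ioo s T, ENNReal.ofReal |C| * ENNReal.ofReal ((u - s) ^ (α₁ - (2 - β))) := by
          refine setLIntegral_mono' measurableSet_Ioo (fun u hu => ?_)
          have hus : 0 < u - s := by linarith [hu.1]
          rw [← ofReal_norm, norm_mul, Real.norm_eq_abs, Real.norm_eq_abs,
            abs_of_nonneg (Real.rpow_nonneg hus.le _), ← ENNReal.ofReal_mul (abs_nonneg _)]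
          apply ENNReal.ofReal_le_ofReal
          rw [sub_eq_add_neg α₁, Real.rpow_add hus, ← mul_assoc]
          gcongr
          exact hC' s ⟨hs.1.le, hs.2.le⟩ u ⟨by linarith [hs.1], hu.2.le⟩ hu.1.le
      _ = ENNReal.ofReal |C| * ∫⁻ u in Ioo s T, ENNReal.ofReal ((u - s) ^ (α₁ - (2 - β))) :=
          lintegral_const_mul _ (by fun_prop)
      _ ≤ _ := by gcongr; exact aux_rpow_right T _ s hs.1.le
  have hDt : ENNReal.ofReal |C| * c3 < ⊤ := ENNReal.mul_lt_top ENNReal.ofReal_lt_top hc3t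
  -- continuous extension of `x`
  let y : ℝ → ℝ := IccExtend hT.le (fun t : Icc (0:ℝ) T => x t)
  have hyc : Continuous y := (continuousOn_iff_continuous_domRestrict.1 hxc).Icc_extend'
  have hxy : ∀ t ∈ Icc (0:ℝ) T, x t = y t := fun t ht => (IccExtend_of_mem hT.le (fun t : Icc (0:ℝ) T => x t) ht).symm
  have hyker : Measurable (fun p : ℝ × ℝ => (y p.1 - y p.2) * (p.2 - p.1) ^ (-(2 - β))) := by
    have := hyc.measurable
    fun_prop
  constructor
  · filter_upwards [ae_lt_top hlm hB'.ne, ae_restrict_mem measurableSet_Ioo] with s hs hsT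
    refine ⟨⟨?_, hs⟩, ⟨?_, (en2 s hsT).trans_lt hDt⟩⟩
    · exact (hker.comp (measurable_prodMk_left (x := s))).aestronglyMeasurable
    · refine (hyker.comp (measurable_prodMk_left (x := s))).aestronglyMeasurable.congr ?_
      filter_upwards [ae_restrict_mem measurableSet_Ioo] with u hu
      simp only [Function.comp]
      rw [hxy s ⟨hsT.1.le, hsT.2.le⟩, hxy u ⟨by linarith [hu.1, hsT.1], hu.2.le⟩]
  · have hI1 : IntegrableOn (fun s => φ s * s ^ (-β)) (Ioo 0 T) := by
      refine ⟨(by fun_prop : Measurable _).aestronglyMeasurable, ?_⟩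
      refine lt_of_eq_of_lt (setLIntegral_congr_fun measurableSet_Ioo (fun s hs => ?_)) hA
      simp only
      rw [← ofReal_norm, norm_mul, Real.norm_eq_abs, Real.norm_eq_abs,
        abs_of_nonneg (Real.rpow_nonneg hs.1.le _)]
    have hI2 : IntegrableOn (fun s => ∫ u in Ioo (0:ℝ) s, (φ s - φ u) * (s - u) ^ (-(1 + β)))
        (Ioo 0 T) := by
      refine ⟨?_, (lintegral_mono fun s => enorm_integral_le_lintegral_enorm _).trans_lt hB'⟩
      have := (hker.indicator hS).stronglyMeasurable.integral_prod_right' (ν := (volume : Measure ℝ))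
      refine this.aestronglyMeasurable.congr (Eventually.of_forall fun s => ?_)
      beta_reduce
      rw [← integral_indicator measurableSet_Ioo]; rfl
    refine Integrable.mul_bdd (c := |C| * T ^ (α₁ - (1 - β)) + |1 - β| * (ENNReal.ofReal |C| * c3).toReal)
      (hI1.add (hI2.const_mul β)) ?_ ?_
    · have hS2 : MeasurableSet {p : ℝ × ℝ | p.2 ∈ Ioo p.1 T} :=
        (measurableSet_lt (f := fun p : ℝ × ℝ => p.1) (g := fun p => p.2)
          (by fun_prop) (by fun_prop)).inter
          (measurableSet_lt (f := fun p : ℝ × ℝ => p.2) (g := fun _ => T)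
          (by fun_prop) (by fun_prop))
      have hm2 : StronglyMeasurable
          (fun s => ∫ u in Ioo s T, (y s - y u) * (u - s) ^ (-(2 - β))) := by
        have := (hyker.indicator hS2).stronglyMeasurable.integral_prod_right'
          (ν := (volume : Measure ℝ))
        convert this using 2 with s
        rw [← integral_indicator measurableSet_Ioo]; rfl
      have hym := hyc.measurable
      have hm1 : Measurable (fun s => (y s - y T) * (T - s) ^ (-(1 - β))) := by fun_prop
      refine (hm1.add (hm2.measurable.const_mul (1 - β))).aestronglyMeasurable.congr ?_
      filter_upwards [ae_restrict_mem measurableSet_Ioo] with s hs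
      simp only [Pi.add_apply]
      rw [hxy s ⟨hs.1.le, hs.2.le⟩, hxy T ⟨hT.le, le_rfl⟩]
      congr 2
      refine setIntegral_congr_fun measurableSet_Ioo (fun u hu => ?_)
      rw [hxy u ⟨by linarith [hu.1, hs.1], hu.2.le⟩]
    · filter_upwards [ae_restrict_mem measurableSet_Ioo] with s hs
      have hTs : 0 < T - s := by linarith [hs.2]
      refine (norm_add_le _ _).trans (add_le_add ?_ ?_)
      · rw [norm_mul, Real.norm_eq_abs, Real.norm_eq_abs,
          abs_of_nonneg (Real.rpow_nonneg hTs.le _)]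
        calc _ ≤ |C| * (T - s) ^ α₁ * (T - s) ^ (-(1 - β)) := by
              gcongr
              exact hC' s ⟨hs.1.le, hs.2.le⟩ T ⟨hT.le, le_rfl⟩ hs.2.le
          _ = |C| * (T - s) ^ (α₁ - (1 - β)) := by
              rw [sub_eq_add_neg α₁, Real.rpow_add hTs, ← mul_assoc]
          _ ≤ _ := by
              gcongr
              · linarith
              · linarith [hs.1]
      · rw [norm_mul, Real.norm_eq_abs]
        gcongr
        rw [← toReal_enorm]
        exact ENNReal.toReal_mono hDt.ne ((enorm_integral_le_lintegral_enorm _).trans (en2 s hs))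
/-- mixed process `Y = V + J` with `V` a.s. `H`-Hölder for every `H < 1/2`
satisfying the bounded-density assumption, and `J` an independent jump-type process with
`P(J_s ≠ J_t) ≤ C|t-s|^{α₂}`: almost surely `‖f(Y_·)‖_{2,β} < ∞`, and consequently for every
process `X` with a.s. `α₁`-Hölder paths the generalized Lebesgue–Stieltjes integral
`∫₀^T f(Y_s) dX_s` exists almost surely. -/
theorem mixed_integral_exists
    {Ω : Type*} [MeasurableSpace Ω] (P : Measure Ω) [IsProbabilityMeasure P]
    (T α₁ α₂ β C : ℝ) (hT : 0 < T) (hα₁ : 1 / 2 < α₁) (hα₂ : 1 - α₁ < α₂) (hC : 0 ≤ C)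
    (hβ : β ∈ Set.Ioo (1 - α₁) (min (1 / 2) α₂))
    (V : ℝ → Ω → ℝ) (hV : Measurable (Function.uncurry V))
    (hVHolder : ∀ H : ℝ, 0 < H → H < 1 / 2 → ∀ᵐ ω ∂P, HolderOnIcc H T (fun t => V t ω))
    (g : ℝ → ℝ) (hg0 : ∀ t, 0 ≤ g t) (hgL1 : IntegrableOn g (Set.Icc 0 T))
    (hdens : BoundedDensityAssumption P T V g)
    (J : ℝ → Ω → ℝ) (hJ : Measurable (Function.uncurry J))
    (hindep : IndepFun (fun ω => fun t => V t ω) (fun ω => fun t => J t ω) P)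
    (hJbdd : ∀ᵐ ω ∂P, ∃ M : ℝ, ∀ t ∈ Set.Icc (0:ℝ) T, |J t ω| ≤ M)
    (hjump : ∀ s ∈ Set.Icc (0:ℝ) T, ∀ t ∈ Set.Icc (0:ℝ) T,
      P {ω | J s ω ≠ J t ω} ≤ ENNReal.ofReal (C * |t - s| ^ α₂))
    (f : ℝ → ℝ) (hf : LocallyBoundedVariationOn f Set.univ)
    (Y : ℝ → Ω → ℝ) (hY : ∀ t ω, Y t ω = V t ω + J t ω) :
    (∀ᵐ ω ∂P,
      (∫⁻ s in Set.Ioo (0:ℝ) T, ENNReal.ofReal (|f (Y s ω)| * s ^ (-β))) < ⊤ ∧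
      (∫⁻ t in Set.Ioo (0:ℝ) T, ∫⁻ s in Set.Ioo (0:ℝ) t,
        ENNReal.ofReal (|f (Y t ω) - f (Y s ω)| * (t - s) ^ (-(1 + β)))) < ⊤) ∧
    (∀ X : ℝ → Ω → ℝ, (∀ᵐ ω ∂P, HolderOnIcc α₁ T (fun t => X t ω)) →
      ∀ᵐ ω ∂P,
        (∀ᵐ s ∂(volume.restrict (Set.Ioo (0:ℝ) T)),
          IntegrableOn (fun u => (f (Y s ω) - f (Y u ω)) * (s - u) ^ (-(1 + β)))
            (Set.Ioo (0:ℝ) s) ∧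
          IntegrableOn (fun u => (X s ω - X u ω) * (u - s) ^ (-(2 - β))) (Set.Ioo s T)) ∧
        IntegrableOn (fun s =>
            (f (Y s ω) * s ^ (-β) +
              β * ∫ u in Set.Ioo (0:ℝ) s, (f (Y s ω) - f (Y u ω)) * (s - u) ^ (-(1 + β))) *
            ((X s ω - X T ω) * (T - s) ^ (-(1 - β)) +
              (1 - β) * ∫ u in Set.Ioo s T, (X s ω - X u ω) * (u - s) ^ (-(2 - β))))
          (Set.Ioo (0:ℝ) T)) := by
  obtain ⟨hfm, v, hv, hfv⟩ := aux_bv f hf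
  obtain ⟨hβ1, hβ2⟩ := hβ
  obtain ⟨hβ3, hβ4⟩ := lt_min_iff.1 hβ2
  obtain ⟨H, hH1, hH2⟩ := exists_between (max_lt hβ3 (by norm_num : (0:ℝ) < 1 / 2))
  obtain ⟨hH3, hH4⟩ := max_lt_iff.1 hH1
  let w : ℕ → ℝ → ℝ := fun N x => v (max (-(N:ℝ)) (min x N))
  have hwmono : ∀ N, Monotone (w N) := fun N x y hxy =>
    hv (max_le_max le_rfl (min_le_min hxy le_rfl))
  have hNN : ∀ N : ℕ, -(N:ℝ) ≤ N := fun N => by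
    have : (0:ℝ) ≤ N := Nat.cast_nonneg N
    linarith
  have hwb : ∀ N x y, w N x - w N y ≤ v N - v (-(N:ℝ)) := fun N x y => by
    have h1 : w N x ≤ v N := hv (max_le (hNN N) (min_le_right _ _))
    have h2 : v (-(N:ℝ)) ≤ w N y := hv (le_max_left _ _)
    linarith
  have hwv : ∀ (N : ℕ) (x : ℝ), |x| ≤ N → w N x = v x := fun N x hx => by
    obtain ⟨h1, h2⟩ := abs_le.1 hx
    simp only [w]
    rw [min_eq_left h2, max_eq_right h1]
  have hcore : ∀ᵐ ω ∂P, ∀ N L : ℕ, ∫⁻ t in Ioo (0:ℝ) T, ∫⁻ s in Ioo (0:ℝ) t,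
      ENNReal.ofReal ((if |V t ω - V s ω| ≤ L * |t - s| ^ H then
        |w N (V t ω + J t ω) - w N (V s ω + J s ω)| else 0) * (t - s) ^ (-(1 + β))) < ⊤ :=
    ae_all_iff.2 fun N => ae_all_iff.2 fun L =>
      aux_core P T α₂ β C hC hβ4 V hV g hgL1 hdens J hJ hindep hjump (w N) (hwmono N) _
        (sub_nonneg.2 (hv (hNN N))) (hwb N) H L (Nat.cast_nonneg L) hH3
  have main : ∀ᵐ ω ∂P,
      (∫⁻ s in Set.Ioo (0:ℝ) T, ENNReal.ofReal (|f (Y s ω)| * s ^ (-β))) < ⊤ ∧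
      (∫⁻ t in Set.Ioo (0:ℝ) T, ∫⁻ s in Set.Ioo (0:ℝ) t,
        ENNReal.ofReal (|f (Y t ω) - f (Y s ω)| * (t - s) ^ (-(1 + β)))) < ⊤ := by
    filter_upwards [hcore, hVHolder H hH4 hH2, hJbdd] with ω hω hHol hJb
    obtain ⟨M₁, hM₁⟩ := isCompact_Icc.exists_bound_of_continuousOn
      (aux_holder_cont H T hH4 _ hHol)
    obtain ⟨M₂, hM₂⟩ := hJb
    obtain ⟨L', hL'⟩ := hHol
    obtain ⟨N, hN⟩ := exists_nat_ge (M₁ + M₂)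
    obtain ⟨L, hL⟩ := exists_nat_ge L'
    have hYN : ∀ t ∈ Icc (0:ℝ) T, |Y t ω| ≤ N := fun t ht => by
      rw [hY]
      exact (abs_add_le _ _).trans ((add_le_add (hM₁ t ht) (hM₂ t ht)).trans hN)
    constructor
    · have hfb : ∀ t ∈ Icc (0:ℝ) T, |f (Y t ω)| ≤ |f 0| + (v N - v (-(N:ℝ))) := fun t ht => by
        have h1 := hfv (Y t ω) 0
        rw [← hwv N _ (hYN t ht), ← hwv N 0 (by simp)] at h1
        have h2 : |w N (Y t ω) - w N 0| ≤ v N - v (-(N:ℝ)) :=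
          abs_le.2 ⟨by linarith [hwb N 0 (Y t ω)], hwb N _ _⟩
        have h3 := abs_sub_abs_le_abs_sub (f (Y t ω)) (f 0)
        linarith
      calc _ ≤ ∫⁻ s in Ioo (0:ℝ) T, ENNReal.ofReal (|f 0| + (v N - v (-(N:ℝ)))) *
            ENNReal.ofReal (s ^ (-β)) := by
            refine setLIntegral_mono' measurableSet_Ioo (fun s hs => ?_)
            rw [ENNReal.ofReal_mul (abs_nonneg _)]
            gcongr
            exact hfb s ⟨hs.1.le, hs.2.le⟩
        _ = _ := lintegral_const_mul _ (by fun_prop)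
        _ < ⊤ := ENNReal.mul_lt_top ENNReal.ofReal_lt_top (aux_rpow_fin T _ (by linarith))
    · refine lt_of_le_of_lt ?_ (hω N L)
      refine setLIntegral_mono' measurableSet_Ioo (fun t ht => ?_)
      refine setLIntegral_mono' measurableSet_Ioo (fun s hs => ?_)
      have htI : t ∈ Icc (0:ℝ) T := ⟨ht.1.le, ht.2.le⟩
      have hsI : s ∈ Icc (0:ℝ) T := ⟨hs.1.le, by linarith [hs.2, ht.2]⟩
      have hle : |V t ω - V s ω| ≤ L * |t - s| ^ H :=
        (hL' s hsI t htI).trans (mul_le_mul_of_nonneg_right hL (Real.rpow_nonneg (abs_nonneg _) _))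
      rw [if_pos hle, ← hY, ← hY, hwv N _ (hYN t htI), hwv N _ (hYN s hsI)]
      apply ENNReal.ofReal_le_ofReal
      exact mul_le_mul_of_nonneg_right (hfv _ _) (Real.rpow_nonneg (by linarith [hs.2]) _)
  refine ⟨main, fun X hX => ?_⟩
  filter_upwards [main, hX] with ω hω hXω
  have hYm : Measurable (fun t => Y t ω) := by
    simp only [hY]
    exact (hV.comp (measurable_prodMk_right (y := ω))).add
      (hJ.comp (measurable_prodMk_right (y := ω)))
  exact aux_det T α₁ β hT (by linarith) hβ1 (fun t => f (Y t ω)) (hfm.comp hYm) hω.1 hω.2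
    (fun t => X t ω) hXω

end
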